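/- arXiv:1707.08270 — 10 statements merged into one kernel-verified Lean document; each statement's English description precedes it below -/
import Mathlib

section
/- Let (X, d) be a metric space, let c > 4 and r > 0, and let H ⊆ X be a set such that for every pair of points u, w ∈ X with r < d(u, w) ≤ cr/2 there exists h ∈ H with d(u, h) + d(h, w) = d(u, w). Let v ∈ X satisfy d(v, h) > 2r for every h ∈ H, and let T = {u ∈ X : d(u, v) ≤ r}. Then for all u, w ∈ T, d(u, w) ≤ r; that is, diam(T) ≤ r. -/
theorem town_diameter_bound {X : Type*} [MetricSpace X]
    (c r : ℝ) (hc : 4 < c) (hr : 0 < r)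
    (H : Set X)
    (hcov : ∀ u w : X, r < dist u w → dist u w ≤ c * r / 2 →
      ∃ h ∈ H, dist u h + dist h w = dist u w)
    (v : X) (hv : ∀ h ∈ H, 2 * r < dist v h)
    (T : Set X) (hT : T = {u : X | dist u v ≤ r}) :
    ∀ u ∈ T, ∀ w ∈ T, dist u w ≤ r := by
  subst hT
  intro u hu w hw
  rw [Set.mem_ofPred_eq] at hu hw
  by_contra! huw
  have huw_le : dist u w ≤ 2 * r := by
    linarith [dist_triangle_right u w v]
  obtain ⟨h, hH, hpath⟩ := hcov u w huw (by nlinarith)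
  have hvu := dist_triangle v u h
  have hvw := dist_triangle v w h
  rw [dist_comm v u] at hvu
  rw [dist_comm v w, dist_comm w h] at hvw
  linarith [hv h hH]
end

section
/- Let (X, d) be a metric space, let c > 4 and r > 0, and let H ⊆ X be a set such that for every pair of points u, w ∈ X with r < d(u, w) ≤ cr/2 there exists h ∈ H with d(u, h) + d(h, w) = d(u, w). Let v ∈ X satisfy d(v, h) > 2r for every h ∈ H, and let T = {u ∈ X : d(u, v) ≤ r}. Then for all u ∈ T and w ∈ X \ T, d(u, w) > r; that is, d(T, X \ T) > r. -/
theorem town_isolation {X : Type*} [MetricSpace X]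
    (c r : ℝ) (hc : 4 < c) (hr : 0 < r)
    (H : Set X)
    (hcov : ∀ u w : X, r < dist u w → dist u w ≤ c * r / 2 →
      ∃ h ∈ H, dist u h + dist h w = dist u w)
    (v : X) (hv : ∀ h ∈ H, 2 * r < dist v h)
    (T : Set X) (hT : T = {u : X | dist u v ≤ r}) :
    ∀ u ∈ T, ∀ w ∈ (Set.univ : Set X) \ T, r < dist u w := by
  subst hT
  rintro u hu w ⟨-, hw⟩
  simp only [Set.mem_ofPred_eq, not_le] at hu hw
  by_contra! huw
  have htri : dist w v ≤ dist u w + dist u v := by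
    simpa only [dist_comm w u] using dist_triangle w u v
  have hcr : 4 * r < c * r := mul_lt_mul_of_pos_right hc hr
  obtain ⟨h, hH, hpath⟩ := hcov w v hw (by linarith)
  have hfar := hv h hH
  rw [dist_comm v h] at hfar
  linarith [dist_nonneg (x := w) (y := h)]
end

section
/- Let (X, d) be a metric space, s ∈ X, and Q a positive integer. Let v₀, v₁, …, v_m be a tour, i.e. a finite list of points of X with v₀ = v_m = s, and let C ⊆ X be a finite set with |C| ≤ Q such that every c ∈ C appears among v₁, …, v_{m−1}. Then the length of the tour satisfies Σ_{i=1}^{m} d(v_{i−1}, v_i) ≥ (2/Q) · Σ_{c ∈ C} d(s, c). -/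
/-- A closed walk based at `v 0` is at least twice as long as the distance to any of its points. -/
theorem two_mul_dist_le_sum_dist_of_closed {X : Type*} [PseudoMetricSpace X] {v : ℕ → X} {m i : ℕ}
    (hv : v m = v 0) (hi : i ≤ m) :
    2 * dist (v 0) (v i) ≤ ∑ j ∈ Finset.range m, dist (v j) (v (j + 1)) := by
  have h₁ := dist_le_range_sum_dist v i
  have h₂ := dist_le_Ico_sum_dist v hi
  rw [hv, dist_comm] at h₂
  rw [← Finset.sum_range_add_sum_Ico _ hi]
  linarith

theorem tour_lower_bound {X : Type*} [MetricSpace X]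
    (s : X) (Q : ℕ) (hQ : 1 ≤ Q)
    (m : ℕ) (v : ℕ → X) (h0 : v 0 = s) (hm : v m = s)
    (C : Finset X) (hC : C.card ≤ Q)
    (hvisit : ∀ c ∈ C, ∃ i : ℕ, 0 < i ∧ i < m ∧ v i = c) :
    (2 / (Q : ℝ)) * ∑ c ∈ C, dist s c ≤
      ∑ i ∈ Finset.range m, dist (v i) (v (i + 1)) := by
  set L := ∑ i ∈ Finset.range m, dist (v i) (v (i + 1))
  have hL : 0 ≤ L := Finset.sum_nonneg fun _ _ => dist_nonneg
  have hQ' : (0 : ℝ) < Q := by exact_mod_cast hQ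
  have hsum : ∑ c ∈ C, 2 * dist s c ≤ C.card • L := by
    refine Finset.sum_le_card_nsmul _ _ _ fun c hc => ?_
    obtain ⟨i, -, hi, rfl⟩ := hvisit c hc
    rw [← h0]
    exact two_mul_dist_le_sum_dist_of_closed (hm.trans h0.symm) hi.le
  rw [← Finset.mul_sum, nsmul_eq_mul] at hsum
  rw [div_mul_eq_mul_div, div_le_iff₀ hQ', mul_comm L]
  exact hsum.trans (mul_le_mul_of_nonneg_right (by exact_mod_cast hC) hL)
end

section
/- (Haimovich–Rinnoy Kan lower bound.) Consider an instance of Capacitated Vehicle Routing with metric space (X, d), depot s, capacity Q, client set Z, and demands ρ with 1 ≤ ρ(c) ≤ Q for every c ∈ Z. Then every feasible solution has cost at least (2/Q) · Σ_{c ∈ Z} d(s, c). -/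
/-- The length of a path visiting the given list of points, under metric `d`:
the sum of distances between consecutive points. -/
def pathLength {X : Type*} (d : X → X → ℝ) : List X → ℝ
  | [] => 0
  | [_] => 0
  | x :: y :: rest => d x y + pathLength d (y :: rest)

/-- The length of a depot-to-depot tour visiting the clients `t` in order. -/
def tourLength {X : Type*} [MetricSpace X] (s : X) (t : List X) : ℝ :=
  pathLength dist (s :: (t ++ [s]))

/-- Feasibility of a collection of tours for Capacitated Vehicle Routing:
every point on a tour is a client, every client appears exactly once over all
tours, and each tour covers at most `Q` units of demand. -/
def FeasibleCVR {X : Type*} [DecidableEq X]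
    (Z : Finset X) (ρ : X → ℕ) (Q : ℕ) (tours : List (List X)) : Prop :=
  (∀ t ∈ tours, ∀ c ∈ t, c ∈ Z) ∧
  (∀ c ∈ Z, (tours.flatMap id).count c = 1) ∧
  (∀ t ∈ tours, (t.map ρ).sum ≤ Q)

theorem pathLength_dist_nonneg {X : Type*} [MetricSpace X] (l : List X) :
    0 ≤ pathLength dist l := by
  induction l with
  | nil => simp [pathLength]
  | cons x l ih =>
    cases l with
    | nil => simp [pathLength]
    | cons y l =>
      simp only [pathLength]
      positivity

theorem dist_le_pathLength {X : Type*} [MetricSpace X] (x s : X) (t : List X) :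
    dist x s ≤ pathLength dist (x :: (t ++ [s])) := by
  induction t generalizing x with
  | nil => simp [pathLength]
  | cons y t ih =>
    simp only [List.cons_append, pathLength]
    linarith [ih y, dist_triangle x y s]

theorem dist_add_dist_le_pathLength {X : Type*} [MetricSpace X] (x s : X) {t : List X} {c : X}
    (hc : c ∈ t) : dist x c + dist c s ≤ pathLength dist (x :: (t ++ [s])) := by
  induction t generalizing x with
  | nil => simp at hc
  | cons y t ih =>
    simp only [List.cons_append, pathLength]
    rcases List.mem_cons.mp hc with rfl | hc
    · linarith [dist_le_pathLength c s t]
    · linarith [ih y hc, dist_triangle x y c]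

theorem two_mul_dist_le_tourLength {X : Type*} [MetricSpace X] (s : X) {t : List X} {c : X}
    (hc : c ∈ t) : 2 * dist s c ≤ tourLength s t := by
  have h := dist_add_dist_le_pathLength s s hc
  rw [dist_comm c s] at h
  unfold tourLength
  linarith

theorem two_mul_sum_dist_le_mul_tourLength {X : Type*} [MetricSpace X] (s : X) {Q : ℕ}
    {t : List X} (ht : t.length ≤ Q) :
    2 * (t.map (dist s)).sum ≤ Q * tourLength s t := by
  have h : (t.map fun c => 2 * dist s c).sum ≤ (t.map fun c => 2 * dist s c).length •
      tourLength s t := by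
    apply List.sum_le_card_nsmul
    intro a ha
    obtain ⟨c, hc, rfl⟩ := List.mem_map.mp ha
    exact two_mul_dist_le_tourLength s hc
  rw [List.sum_map_mul_left, List.length_map, nsmul_eq_mul] at h
  refine h.trans (mul_le_mul_of_nonneg_right (by exact_mod_cast ht) ?_)
  exact pathLength_dist_nonneg _

theorem FeasibleCVR.sum_eq {X M : Type*} [DecidableEq X] [AddCommMonoid M] {Z : Finset X}
    {ρ : X → ℕ} {Q : ℕ} {tours : List (List X)} (h : FeasibleCVR Z ρ Q tours) (f : X → M) :
    ∑ c ∈ Z, f c = (tours.map fun t => (t.map f).sum).sum := by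
  obtain ⟨hmem, hcount, -⟩ := h
  have hZ : ∀ c ∈ tours.flatMap id, c ∈ Z := by
    intro c hc
    obtain ⟨t, ht, hct⟩ := List.mem_flatMap.mp hc
    exact hmem t ht c hct
  have hnodup : (tours.flatMap id).Nodup :=
    List.nodup_iff_count_eq_one.mpr fun c hc => hcount c (hZ c hc)
  have hfin : (tours.flatMap id).toFinset = Z := by
    ext c
    rw [List.mem_toFinset]
    exact ⟨hZ c, fun hc => List.count_pos_iff.mp (by rw [hcount c hc]; exact one_pos)⟩
  rw [← hfin, List.sum_toFinset f hnodup]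
  clear hmem hcount hZ hnodup hfin
  induction tours with
  | nil => simp
  | cons t l ih => simp [← ih]

theorem FeasibleCVR.length_le {X : Type*} [DecidableEq X] {Z : Finset X}
    {ρ : X → ℕ} {Q : ℕ} {tours : List (List X)} (h : FeasibleCVR Z ρ Q tours)
    (hρ : ∀ c ∈ Z, 1 ≤ ρ c) {t : List X} (ht : t ∈ tours) : t.length ≤ Q := by
  have hle : (t.map ρ).length • 1 ≤ (t.map ρ).sum := by
    apply List.card_nsmul_le_sum
    intro a ha
    obtain ⟨c, hc, rfl⟩ := List.mem_map.mp ha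
    exact hρ c (h.1 t ht c hc)
  rw [List.length_map, smul_eq_mul, mul_one] at hle
  exact hle.trans (h.2.2 t ht)

theorem haimovich_rinnoy_kan_lower_bound {X : Type*} [MetricSpace X] [DecidableEq X]
    (s : X) (Q : ℕ) (hQ : 1 ≤ Q)
    (Z : Finset X) (hsZ : s ∉ Z)
    (ρ : X → ℕ) (hρ : ∀ c ∈ Z, 1 ≤ ρ c ∧ ρ c ≤ Q)
    (tours : List (List X)) (hfeas : FeasibleCVR Z ρ Q tours) :
    (2 / (Q : ℝ)) * ∑ c ∈ Z, dist s c ≤ (tours.map (tourLength s)).sum := by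
  have hQ' : (0 : ℝ) < Q := by exact_mod_cast hQ
  rw [div_mul_eq_mul_div, div_le_iff₀' hQ', hfeas.sum_eq (dist s), ← List.sum_map_mul_left,
    ← List.sum_map_mul_left]
  exact List.sum_le_sum fun t ht =>
    two_mul_sum_dist_le_mul_tourLength s (hfeas.length_le (fun c hc => (hρ c hc).1) ht)
end

section
/- Let (X, d) be a metric space, s ∈ X, ε > 0, and X' ⊆ X. Let (Y_k)_{k ≥ 0} be a sequence of subsets of X such that Y₀ is an ε-covering of X' ∩ B̄(s, 1), and for every k ≥ 0, Y_{k+1} is an ε·2^{k+1}-covering of the set (X' ∩ (B̄(s, 2^{k+1}) \ B̄(s, 2^k))) ∪ Y_k. Then for every k ≥ 0, Y_k is an ε·2^{k+1}-covering of X' ∩ B̄(s, 2^k). -/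
/-- `Y` is a `δ`-covering of `A`: every point of `A` is within distance `δ`
of some point of `Y`. -/
def IsCovering {X : Type*} [MetricSpace X] (δ : ℝ) (Y A : Set X) : Prop :=
  ∀ x ∈ A, ∃ y ∈ Y, dist x y ≤ δ

theorem nested_nets_covering {X : Type*} [MetricSpace X]
    (s : X) (ε : ℝ) (hε : 0 < ε) (X' : Set X) (Y : ℕ → Set X)
    (h0 : IsCovering ε (Y 0) (X' ∩ Metric.closedBall s 1))
    (hk : ∀ k : ℕ, IsCovering (ε * 2 ^ (k + 1)) (Y (k + 1))
      ((X' ∩ (Metric.closedBall s (2 ^ (k + 1)) \ Metric.closedBall s (2 ^ k))) ∪ Y k)) :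
    ∀ k : ℕ, IsCovering (ε * 2 ^ (k + 1)) (Y k) (X' ∩ Metric.closedBall s (2 ^ k)) := by
  intro k
  induction k with
  | zero =>
    rintro x ⟨hx, hxs⟩
    obtain ⟨y, hy, hxy⟩ := h0 x ⟨hx, by simpa using hxs⟩
    exact ⟨y, hy, by rw [zero_add, pow_one]; linarith⟩
  | succ k ih =>
    rintro x ⟨hx, hxs⟩
    have hpos : 0 < ε * 2 ^ (k + 1) := by positivity
    have hdouble : ε * 2 ^ (k + 1 + 1) = ε * 2 ^ (k + 1) + ε * 2 ^ (k + 1) := by ring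
    rw [hdouble]
    by_cases hball : x ∈ Metric.closedBall s (2 ^ k)
    · obtain ⟨y, hy, hxy⟩ := ih x ⟨hx, hball⟩
      obtain ⟨z, hz, hyz⟩ := hk k y (Or.inr hy)
      exact ⟨z, hz, (dist_triangle x y z).trans (add_le_add hxy hyz)⟩
    · obtain ⟨y, hy, hxy⟩ := hk k x (Or.inl ⟨hx, hxs, hball⟩)
      exact ⟨y, hy, by linarith⟩
end

section
/- (k-center transfer.) Let V be a nonempty finite set equipped with two metrics d_G and d_H such that d_G(u, v) ≤ d_H(u, v) for all u, v ∈ V. Let k ≥ 1, ε ≥ 0, α ≥ 1, and let OPT_G = min{cost_{d_G}(F) : F ⊆ V, |F| = k} where cost_d(F) = max_{v ∈ V} min_{f ∈ F} d(v, f). Suppose S ⊆ V is a nonempty set with cost_{d_G}(S) ≤ α·OPT_G, and suppose d_H(u, v) ≤ (1 + ε)·d_G(u, v) + ε·min(d_G(u, S), d_G(v, S)) for all u, v ∈ V, where d_G(x, S) = min_{w ∈ S} d_G(x, w). Then for any F ⊆ V with |F| = k satisfying cost_{d_H}(F) ≤ (1 + ε)·min{cost_{d_H}(F') : F' ⊆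 V, |F'| = k}, we have cost_{d_G}(F) ≤ (1 + ε)·(1 + (1 + α)ε)·OPT_G. -/
/-- The `k`-center cost of a set `F` of centers: the maximum over all vertices
of the distance to the nearest center. -/
noncomputable def kCenterCost {V : Type*} [Fintype V] (d : V → V → ℝ) (F : Finset V) : ℝ :=
  ⨆ v : V, ⨅ f : F, d v (f : V)

/-- The optimum `k`-center cost: the minimum cost over all sets of `k` centers. -/
noncomputable def kCenterOpt {V : Type*} [Fintype V] (d : V → V → ℝ) (k : ℕ) : ℝ :=
  sInf {x : ℝ | ∃ F : Finset V, F.card = k ∧ x = kCenterCost d F}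

theorem kCenterCost_le_iff {V : Type*} [Fintype V] [Nonempty V] (d : V → V → ℝ)
    {F : Finset V} (hF : F.Nonempty) (r : ℝ) :
    kCenterCost d F ≤ r ↔ ∀ v, ∃ f ∈ F, d v f ≤ r := by
  have : Nonempty F := hF.to_subtype
  unfold kCenterCost
  rw [ciSup_le_iff (Set.finite_range _).bddAbove]
  refine forall_congr' fun v => ⟨fun h => ?_, fun ⟨f, hf, h⟩ => ?_⟩
  · obtain ⟨f, hf⟩ := exists_eq_ciInf_of_finite (f := fun f : F => d v f)
    exact ⟨f, f.2, hf.le.trans h⟩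
  · exact (ciInf_le (Set.finite_range fun f : F => d v f).bddBelow ⟨f, hf⟩).trans h

theorem finite_kCenterCost_values {V : Type*} [Fintype V] (d : V → V → ℝ) (k : ℕ) :
    {x : ℝ | ∃ F : Finset V, F.card = k ∧ x = kCenterCost d F}.Finite :=
  (Set.finite_range fun F : Finset V => kCenterCost d F).subset
    fun _ ⟨F, _, h⟩ => ⟨F, h.symm⟩

theorem kCenterOpt_le {V : Type*} [Fintype V] (d : V → V → ℝ) (F : Finset V) :
    kCenterOpt d F.card ≤ kCenterCost d F :=
  csInf_le (finite_kCenterCost_values d F.card).bddBelow ⟨F, rfl, rfl⟩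

theorem exists_kCenterOpt_eq {V : Type*} [Fintype V] (d : V → V → ℝ) (F : Finset V) :
    ∃ F' : Finset V, F'.card = F.card ∧ kCenterOpt d F.card = kCenterCost d F' :=
  Set.Nonempty.csInf_mem (s := {x : ℝ | ∃ F' : Finset V, F'.card = F.card ∧ x = kCenterCost d F'})
    ⟨_, F, rfl, rfl⟩ (finite_kCenterCost_values d F.card)

theorem kCenter_transfer {V : Type*} [Fintype V] [Nonempty V]
    (dG dH : V → V → ℝ)
    (hGself : ∀ x, dG x x = 0) (hGeq : ∀ x y, dG x y = 0 → x = y)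
    (hGsymm : ∀ x y, dG x y = dG y x)
    (hGtri : ∀ x y z, dG x z ≤ dG x y + dG y z)
    (hHself : ∀ x, dH x x = 0) (hHeq : ∀ x y, dH x y = 0 → x = y)
    (hHsymm : ∀ x y, dH x y = dH y x)
    (hHtri : ∀ x y z, dH x z ≤ dH x y + dH y z)
    (k : ℕ) (hk : 1 ≤ k) (ε α : ℝ) (hε : 0 ≤ ε) (hα : 1 ≤ α)
    (hle : ∀ u v, dG u v ≤ dH u v)
    (S : Finset V) (hS : S.Nonempty)
    (hSapx : kCenterCost dG S ≤ α * kCenterOpt dG k)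
    (hub : ∀ u v, dH u v ≤ (1 + ε) * dG u v +
      ε * min (⨅ w : S, dG u (w : V)) (⨅ w : S, dG v (w : V)))
    (F : Finset V) (hF : F.card = k)
    (hFapx : kCenterCost dH F ≤ (1 + ε) * kCenterOpt dH k) :
    kCenterCost dG F ≤ (1 + ε) * (1 + (1 + α) * ε) * kCenterOpt dG k := by
  subst hF
  have hFne : F.Nonempty := Finset.card_pos.mp hk
  obtain ⟨F', hcard, hopt⟩ := exists_kCenterOpt_eq dG F
  have hF'ne : F'.Nonempty := Finset.card_pos.mp (hcard ▸ hk)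
  have hGH : kCenterCost dG F ≤ kCenterCost dH F := by
    rw [kCenterCost_le_iff dG hFne]
    intro v
    obtain ⟨f, hf, h⟩ := (kCenterCost_le_iff dH hFne _).mp le_rfl v
    exact ⟨f, hf, (hle v f).trans h⟩
  have hF' : kCenterCost dH F' ≤ (1 + (1 + α) * ε) * kCenterOpt dG F.card := by
    rw [kCenterCost_le_iff dH hF'ne]
    intro v
    obtain ⟨f, hf, h⟩ := (kCenterCost_le_iff dG hF'ne _).mp hopt.ge v
    refine ⟨f, hf, (hub v f).trans ?_⟩
    have hv : (⨅ w : S, dG v (w : V)) ≤ α * kCenterOpt dG F.card :=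
      (le_ciSup (f := fun v => ⨅ w : S, dG v (w : V))
        (Set.finite_range _).bddAbove v).trans hSapx
    have hmin := mul_le_mul_of_nonneg_left ((min_le_left _ (⨅ w : S, dG f (w : V))).trans hv) hε
    have hdist := mul_le_mul_of_nonneg_left h (by linarith : 0 ≤ 1 + ε)
    linarith
  have hH : kCenterOpt dH F.card ≤ kCenterCost dH F' := hcard ▸ kCenterOpt_le dH F'
  calc kCenterCost dG F ≤ (1 + ε) * kCenterOpt dH F.card := hGH.trans hFapx
    _ ≤ (1 + ε) * ((1 + (1 + α) * ε) * kCenterOpt dG F.card) := by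
      gcongr
      exact hH.trans hF'
    _ = _ := by ring
end

section
/- (k-median transfer.) Let V be a nonempty finite set equipped with two metrics d_G and d_H such that d_G(u, v) ≤ d_H(u, v) for all u, v ∈ V. Let k ≥ 1, ε ≥ 0, α ≥ 1, and let OPT_G = min{cost_{d_G}(F) : F ⊆ V, |F| = k} where cost_d(F) = Σ_{v ∈ V} min_{f ∈ F} d(v, f). Suppose S ⊆ V is a nonempty set with cost_{d_G}(S) ≤ α·OPT_G, and suppose d_H(u, v) ≤ (1 + ε)·d_G(u, v) + ε·min(d_G(u, S), d_G(v, S)) for all u, v ∈ V, where d_G(x, S) = min_{w ∈ S} d_G(x, w). Then for any F ⊆ V with |F| = k satisfying cost_{d_H}(F) ≤ (1 + ε)·min{cost_{d_H}(F') : F' ⊆ V, |F'| = k}, we have cost_{d_G}(F) ≤ (1 + ε)·(1 + (1 + α)ε)·OPT_G. -/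
/-- The `k`-median cost of a set `F` of centers: the sum over all vertices
of the distance to the nearest center. -/
noncomputable def kMedianCost {V : Type*} [Fintype V] (d : V → V → ℝ) (F : Finset V) : ℝ :=
  ∑ v : V, ⨅ f : F, d v (f : V)

/-- The optimum `k`-median cost: the minimum cost over all sets of `k` centers. -/
noncomputable def kMedianOpt {V : Type*} [Fintype V] (d : V → V → ℝ) (k : ℕ) : ℝ :=
  sInf {x : ℝ | ∃ F : Finset V, F.card = k ∧ x = kMedianCost d F}

theorem finite_setOf_kMedianCost {V : Type*} [Fintype V] (d : V → V → ℝ) (k : ℕ) :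
    {x : ℝ | ∃ F : Finset V, F.card = k ∧ x = kMedianCost d F}.Finite :=
  (Set.finite_range (kMedianCost d)).subset (by rintro _ ⟨F, _, rfl⟩; exact ⟨F, rfl⟩)

theorem kMedianOpt_le {V : Type*} [Fintype V] (d : V → V → ℝ) {k : ℕ} {F : Finset V}
    (hF : F.card = k) : kMedianOpt d k ≤ kMedianCost d F :=
  csInf_le (finite_setOf_kMedianCost d k).bddBelow ⟨F, hF, rfl⟩

theorem exists_kMedianOpt_eq {V : Type*} [Fintype V] (d : V → V → ℝ) {k : ℕ}
    (h : ∃ F : Finset V, F.card = k) :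
    ∃ F : Finset V, F.card = k ∧ kMedianOpt d k = kMedianCost d F := by
  obtain ⟨F, hF⟩ := h
  have hne : {x : ℝ | ∃ F : Finset V, F.card = k ∧ x = kMedianCost d F}.Nonempty :=
    ⟨_, F, hF, rfl⟩
  exact hne.csInf_mem (finite_setOf_kMedianCost d k)

theorem kMedianCost_mono {V : Type*} [Fintype V] {d d' : V → V → ℝ}
    (h : ∀ u v, d u v ≤ d' u v) (F : Finset V) : kMedianCost d F ≤ kMedianCost d' F :=
  Finset.sum_le_sum fun v _ => ciInf_mono (Set.finite_range _).bddBelow fun f => h v f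

theorem kMedianCost_le_of_le_add {V : Type*} [Fintype V] {d d' : V → V → ℝ} {a b : ℝ}
    {F S : Finset V} (hF : F.Nonempty)
    (h : ∀ u v, d' u v ≤ a * d u v + b * ⨅ w : S, d u (w : V)) :
    kMedianCost d' F ≤ a * kMedianCost d F + b * kMedianCost d S := by
  have : Nonempty F := hF.to_subtype
  unfold kMedianCost
  rw [Finset.mul_sum, Finset.mul_sum, ← Finset.sum_add_distrib]
  refine Finset.sum_le_sum fun v _ => ?_
  obtain ⟨f, hf⟩ := exists_eq_ciInf_of_finite (f := fun f : F => d v (f : V))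
  rw [← hf]
  exact (ciInf_le (Set.finite_range _).bddBelow f).trans (h v f)

theorem kMedian_transfer {V : Type*} [Fintype V] [Nonempty V]
    (dG dH : V → V → ℝ)
    (hGself : ∀ x, dG x x = 0) (hGeq : ∀ x y, dG x y = 0 → x = y)
    (hGsymm : ∀ x y, dG x y = dG y x)
    (hGtri : ∀ x y z, dG x z ≤ dG x y + dG y z)
    (hHself : ∀ x, dH x x = 0) (hHeq : ∀ x y, dH x y = 0 → x = y)
    (hHsymm : ∀ x y, dH x y = dH y x)
    (hHtri : ∀ x y z, dH x z ≤ dH x y + dH y z)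
    (k : ℕ) (hk : 1 ≤ k) (ε α : ℝ) (hε : 0 ≤ ε) (hα : 1 ≤ α)
    (hle : ∀ u v, dG u v ≤ dH u v)
    (S : Finset V) (hS : S.Nonempty)
    (hSapx : kMedianCost dG S ≤ α * kMedianOpt dG k)
    (hub : ∀ u v, dH u v ≤ (1 + ε) * dG u v +
      ε * min (⨅ w : S, dG u (w : V)) (⨅ w : S, dG v (w : V)))
    (F : Finset V) (hF : F.card = k)
    (hFapx : kMedianCost dH F ≤ (1 + ε) * kMedianOpt dH k) :
    kMedianCost dG F ≤ (1 + ε) * (1 + (1 + α) * ε) * kMedianOpt dG k := by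
  obtain ⟨F', hF', hopt⟩ := exists_kMedianOpt_eq dG ⟨F, hF⟩
  have hne : F'.Nonempty := Finset.card_pos.mp (by omega)
  have hcost : kMedianCost dH F' ≤ (1 + ε) * kMedianCost dG F' + ε * kMedianCost dG S :=
    kMedianCost_le_of_le_add hne fun u v => (hub u v).trans (by gcongr; exact min_le_left _ _)
  have hoptH : kMedianOpt dH k ≤ (1 + (1 + α) * ε) * kMedianOpt dG k := by
    rw [← hopt] at hcost
    linarith [kMedianOpt_le dH hF', mul_le_mul_of_nonneg_left hSapx hε]
  calc kMedianCost dG F ≤ kMedianCost dH F := kMedianCost_mono hle F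
    _ ≤ (1 + ε) * kMedianOpt dH k := hFapx
    _ ≤ (1 + ε) * ((1 + (1 + α) * ε) * kMedianOpt dG k) := by gcongr
    _ = _ := by ring
end

section
/- (Vehicle-routing transfer.) Let X be a set equipped with two metrics d_G and d_H, let s ∈ X, Q an integer ≥ 1, and ε ≥ 0, and suppose that for all u, v ∈ X: d_G(u, v) ≤ d_H(u, v) ≤ d_G(u, v) + ε·(d_G(s, u) + d_G(s, v)). Fix an instance of Capacitated Vehicle Routing with depot s, capacity Q, finite client set Z ⊆ X with s ∉ Z, and demands ρ : Z → ℕ with 1 ≤ ρ(c) ≤ Q; feasibility of a solution does not depend on the metric. Then: (i) for every feasible solution P, cost_H(P) ≤ cost_G(P) + 2ε·Σ_{c ∈ Z} d_G(s, c) ≤ (1 + εQ)·cost_G(P); and (ii) if P* is a feasible solution minimizing cost_H among all feasible solutions, then cost_G(P*) ≤ (1 + εQ)·cost_G(P) for every feasible solution P. -/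
/-- The cost, under metric `d`, of a collection of depot-to-depot tours. -/
def solCost {X : Type*} (d : X → X → ℝ) (s : X) (tours : List (List X)) : ℝ :=
  (tours.map (fun t => pathLength d (s :: (t ++ [s])))).sum

section PathLength

variable {X : Type*} {d d' : X → X → ℝ}

theorem pathLength_mono (h : ∀ u v, d u v ≤ d' u v) :
    ∀ l : List X, pathLength d l ≤ pathLength d' l
  | [] => le_rfl
  | [_] => le_rfl
  | x :: y :: l => add_le_add (h x y) (pathLength_mono h (y :: l))

theorem solCost_mono (h : ∀ u v, d u v ≤ d' u v) (s : X) (P : List (List X)) :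
    solCost d s P ≤ solCost d' s P :=
  List.sum_le_sum fun _ _ => pathLength_mono h _

theorem le_pathLength (htri : ∀ x y z, d x z ≤ d x y + d y z) (t : List X) (x y : X) :
    d x y ≤ pathLength d (x :: (t ++ [y])) := by
  induction t generalizing x with
  | nil => simp [pathLength]
  | cons a t ih =>
    simp only [List.cons_append, pathLength]
    linarith [ih a, htri x a y]

theorem le_pathLength_of_mem (htri : ∀ x y z, d x z ≤ d x y + d y z) {t : List X} {c : X}
    (hc : c ∈ t) (x y : X) :
    d x c + d c y ≤ pathLength d (x :: (t ++ [y])) := by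
  induction t generalizing x with
  | nil => simp at hc
  | cons a t ih =>
    simp only [List.cons_append, pathLength]
    rcases List.mem_cons.1 hc with rfl | hc
    · linarith [le_pathLength htri t c y]
    · linarith [ih hc a, htri x a c]

/-- An additive distortion `ε * (w u + w v)` on each edge costs `2 * ε * w c` for each interior
point `c` of a path, and half of that at the two endpoints. -/
theorem pathLength_le_add {w : X → ℝ} {ε : ℝ}
    (h : ∀ u v, d' u v ≤ d u v + ε * (w u + w v)) (t : List X) (x y : X) :
    pathLength d' (x :: (t ++ [y])) ≤
      pathLength d (x :: (t ++ [y])) + ε * (w x + 2 * (t.map w).sum + w y) := by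
  induction t generalizing x with
  | nil => simpa [pathLength] using h x y
  | cons a t ih =>
    simp only [List.cons_append, pathLength, List.map_cons, List.sum_cons]
    linarith [ih a, h x a]

theorem solCost_le_add {s : X} {w : X → ℝ} (hw : w s = 0) {ε : ℝ}
    (h : ∀ u v, d' u v ≤ d u v + ε * (w u + w v)) (P : List (List X)) :
    solCost d' s P ≤ solCost d s P + 2 * ε * (P.map fun t => (t.map w).sum).sum := by
  induction P with
  | nil => simp [solCost]
  | cons t P ih =>
    have ht := pathLength_le_add h t s s
    simp only [solCost, List.map_cons, List.sum_cons] at ih ⊢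
    rw [hw] at ht
    linarith

/-- The radial lower bound for a single tour. -/
theorem two_mul_sum_le_mul_pathLength (hself : ∀ x, d x x = 0)
    (hsymm : ∀ x y, d x y = d y x) (htri : ∀ x y z, d x z ≤ d x y + d y z)
    (s : X) {t : List X} {Q : ℕ} (ht : t.length ≤ Q) :
    2 * (t.map (d s)).sum ≤ Q * pathLength d (s :: (t ++ [s])) := by
  have hsum := List.sum_le_card_nsmul (t.map (d s)) (pathLength d (s :: (t ++ [s])) / 2) (by
    simp only [List.mem_map]
    rintro _ ⟨c, hc, rfl⟩
    linarith [le_pathLength_of_mem htri hc s s, hsymm c s])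
  have hpos : 0 ≤ pathLength d (s :: (t ++ [s])) :=
    (hself s).symm.le.trans (le_pathLength htri t s s)
  rw [List.length_map, nsmul_eq_mul] at hsum
  have hQ : (t.length : ℝ) ≤ Q := by exact_mod_cast ht
  nlinarith [mul_le_mul_of_nonneg_right hQ hpos]

/-- The Haimovich–Rinnooy Kan radial lower bound. -/
theorem two_mul_sum_le_mul_solCost (hself : ∀ x, d x x = 0)
    (hsymm : ∀ x y, d x y = d y x) (htri : ∀ x y z, d x z ≤ d x y + d y z)
    (s : X) {P : List (List X)} {Q : ℕ} (hP : ∀ t ∈ P, t.length ≤ Q) :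
    2 * (P.map fun t => (t.map (d s)).sum).sum ≤ Q * solCost d s P := by
  rw [solCost, ← List.sum_map_mul_left, ← List.sum_map_mul_left]
  exact List.sum_le_sum fun t ht => two_mul_sum_le_mul_pathLength hself hsymm htri s (hP t ht)

end PathLength

namespace FeasibleCVR

variable {X : Type*} [DecidableEq X] {Z : Finset X} {ρ : X → ℕ} {Q : ℕ} {P : List (List X)}

theorem sum_map_eq (hP : FeasibleCVR Z ρ Q P) (f : X → ℝ) :
    (P.map fun t => (t.map f).sum).sum = ∑ c ∈ Z, f c := by
  obtain ⟨hmem, hcount, -⟩ := hP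
  have hZ : ∀ c ∈ P.flatMap id, c ∈ Z := by
    intro c hc
    obtain ⟨t, ht, hct⟩ := List.mem_flatMap.1 hc
    exact hmem t ht c hct
  have hnodup : (P.flatMap id).Nodup := List.nodup_iff_count_le_one.2 fun c => by
    by_cases hc : c ∈ P.flatMap id
    · exact (hcount c (hZ c hc)).le
    · exact (List.count_eq_zero_of_not_mem hc).trans_le zero_le_one
  have hfin : (P.flatMap id).toFinset = Z := by
    ext c
    rw [List.mem_toFinset]
    exact ⟨hZ c, fun hc => List.count_pos_iff.1 (by rw [hcount c hc]; exact one_pos)⟩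
  rw [← hfin, List.sum_toFinset f hnodup, List.flatMap_id, List.map_flatten, List.sum_flatten,
    List.map_map]
  rfl

theorem length_le_s15 (hP : FeasibleCVR Z ρ Q P) (hρ : ∀ c ∈ Z, 1 ≤ ρ c) {t : List X} (ht : t ∈ P) :
    t.length ≤ Q := by
  refine le_trans ?_ (hP.2.2 t ht)
  have h := List.card_nsmul_le_sum (t.map ρ) 1 (by
    simp only [List.mem_map]
    rintro _ ⟨c, hc, rfl⟩
    exact hρ c (hP.1 t ht c hc))
  simpa using h

end FeasibleCVR

theorem vehicle_routing_transfer {X : Type*} [DecidableEq X]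
    (dG dH : X → X → ℝ)
    (hGself : ∀ x, dG x x = 0) (hGeq : ∀ x y, dG x y = 0 → x = y)
    (hGsymm : ∀ x y, dG x y = dG y x)
    (hGtri : ∀ x y z, dG x z ≤ dG x y + dG y z)
    (hHself : ∀ x, dH x x = 0) (hHeq : ∀ x y, dH x y = 0 → x = y)
    (hHsymm : ∀ x y, dH x y = dH y x)
    (hHtri : ∀ x y z, dH x z ≤ dH x y + dH y z)
    (s : X) (Q : ℕ) (hQ : 1 ≤ Q) (ε : ℝ) (hε : 0 ≤ ε)
    (hle : ∀ u v, dG u v ≤ dH u v)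
    (hub : ∀ u v, dH u v ≤ dG u v + ε * (dG s u + dG s v))
    (Z : Finset X) (hsZ : s ∉ Z)
    (ρ : X → ℕ) (hρ : ∀ c ∈ Z, 1 ≤ ρ c ∧ ρ c ≤ Q) :
    (∀ P : List (List X), FeasibleCVR Z ρ Q P →
      solCost dH s P ≤ solCost dG s P + 2 * ε * ∑ c ∈ Z, dG s c ∧
      solCost dG s P + 2 * ε * ∑ c ∈ Z, dG s c ≤ (1 + ε * Q) * solCost dG s P) ∧
    (∀ Pstar : List (List X), FeasibleCVR Z ρ Q Pstar →
      (∀ P : List (List X), FeasibleCVR Z ρ Q P → solCost dH s Pstar ≤ solCost dH s P) →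
      ∀ P : List (List X), FeasibleCVR Z ρ Q P →
        solCost dG s Pstar ≤ (1 + ε * Q) * solCost dG s P) := by
  have hmain : ∀ P : List (List X), FeasibleCVR Z ρ Q P →
      solCost dH s P ≤ solCost dG s P + 2 * ε * ∑ c ∈ Z, dG s c ∧
      solCost dG s P + 2 * ε * ∑ c ∈ Z, dG s c ≤ (1 + ε * Q) * solCost dG s P := by
    intro P hP
    rw [← hP.sum_map_eq (dG s)]
    refine ⟨solCost_le_add (hGself s) hub P, ?_⟩
    have hradial := two_mul_sum_le_mul_solCost hGself hGsymm hGtri s fun t ht =>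
      hP.length_le_s15 (fun c hc => (hρ c hc).1) ht
    linarith [mul_le_mul_of_nonneg_left hradial hε]
  refine ⟨hmain, fun Pstar _ hopt P hP => ?_⟩
  calc solCost dG s Pstar ≤ solCost dH s Pstar := solCost_mono hle s Pstar
    _ ≤ solCost dH s P := hopt P hP
    _ ≤ (1 + ε * Q) * solCost dG s P := (hmain P hP).1.trans (hmain P hP).2
end

section
/- Let (X, d) be a metric space, let S ⊆ X be a nonempty set, let 0 ≤ ε ≤ 1, and let u, v, h, ĥ ∈ X satisfy d(u, h) + d(h, v) ≤ (1 + ε)·d(u, v) and d(h, ĥ) ≤ 2ε·d(h, S), where d(x, S) denotes the infimum of d(x, w) over w ∈ S. Then d(u, ĥ) + d(ĥ, v) ≤ (1 + 9ε)·d(u, v) + 4ε·min(d(u, S), d(v, S)). -/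
theorem multi_depot_hub_case_both_adjacent {X : Type*} [MetricSpace X]
    (S : Set X) (hS : S.Nonempty)
    (ε : ℝ) (hε0 : 0 ≤ ε) (hε1 : ε ≤ 1)
    (u v h hhat : X)
    (hh : dist u h + dist h v ≤ (1 + ε) * dist u v)
    (hnet : dist h hhat ≤ 2 * ε * Metric.infDist h S) :
    dist u hhat + dist hhat v ≤
      (1 + 9 * ε) * dist u v +
        4 * ε * min (Metric.infDist u S) (Metric.infDist v S) := by
  have hD : (1 + ε) * dist u v ≤ 2 * dist u v :=
    mul_le_mul_of_nonneg_right (by linarith) dist_nonneg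
  have huh : (0 : ℝ) ≤ dist u h := dist_nonneg
  have hhv : (0 : ℝ) ≤ dist h v := dist_nonneg
  have hu : Metric.infDist h S ≤ Metric.infDist u S + dist h u :=
    Metric.infDist_le_infDist_add_dist
  have hv : Metric.infDist h S ≤ Metric.infDist v S + dist h v :=
    Metric.infDist_le_infDist_add_dist
  rw [dist_comm h u] at hu
  have hmin : Metric.infDist h S - 2 * dist u v ≤
      min (Metric.infDist u S) (Metric.infDist v S) :=
    le_min (by linarith) (by linarith)
  have hmul := mul_le_mul_of_nonneg_left hmin (by linarith : 0 ≤ 4 * ε)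
  have hu' := dist_triangle u h hhat
  have hv' := dist_triangle hhat h v
  rw [dist_comm hhat h] at hv'
  linarith
end

section
/- Let (X, d) be a metric space, let S ⊆ X be a nonempty set, let 0 ≤ ε ≤ 1, and let u, v, h, ĥ ∈ X and s_u ∈ S satisfy: d(u, h) + d(h, v) ≤ (1 + ε)·d(u, v); d(h, ĥ) ≤ 2ε·d(h, S); d(u, s_u) = d(u, S); and d(u, S) ≤ ε·d(h, S), where d(x, S) denotes the infimum of d(x, w) over w ∈ S. Then d(u, s_u) + d(s_u, ĥ) + d(ĥ, v) ≤ (1 + 13ε)·d(u, v) + 6ε·min(d(u, S), d(v, S)). -/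
theorem multi_depot_hub_case_one_adjacent {X : Type*} [MetricSpace X]
    (S : Set X) (hS : S.Nonempty)
    (ε : ℝ) (hε0 : 0 ≤ ε) (hε1 : ε ≤ 1)
    (u v h hhat : X) (su : X) (hsu : su ∈ S)
    (hh : dist u h + dist h v ≤ (1 + ε) * dist u v)
    (hnet : dist h hhat ≤ 2 * ε * Metric.infDist h S)
    (hsu_closest : dist u su = Metric.infDist u S)
    (hfar : Metric.infDist u S ≤ ε * Metric.infDist h S) :
    dist u su + dist su hhat + dist hhat v ≤
      (1 + 13 * ε) * dist u v +
        6 * ε * min (Metric.infDist u S) (Metric.infDist v S) := by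
  have hL : (1 + ε) * dist u v ≤ 2 * dist u v :=
    mul_le_mul_of_nonneg_right (by linarith) dist_nonneg
  have hDu : Metric.infDist h S ≤ Metric.infDist u S + dist h u :=
    Metric.infDist_le_infDist_add_dist
  have hDv : Metric.infDist h S ≤ Metric.infDist v S + dist h v :=
    Metric.infDist_le_infDist_add_dist
  have hD : Metric.infDist h S ≤
      2 * dist u v + min (Metric.infDist u S) (Metric.infDist v S) := by
    rw [← sub_le_iff_le_add', le_min_iff]
    have huh : 0 ≤ dist u h := dist_nonneg
    have hhv : 0 ≤ dist h v := dist_nonneg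
    rw [dist_comm h u] at hDu
    constructor <;> linarith
  have hεD := mul_le_mul_of_nonneg_left hD hε0
  have hsuhat : dist su hhat ≤ dist u su + dist u h + dist h hhat := by
    simpa only [dist_comm su u] using dist_triangle4 su u h hhat
  have hhatv : dist hhat v ≤ dist h hhat + dist h v := by
    simpa only [dist_comm hhat h] using dist_triangle hhat h v
  linarith
end
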